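/- No arm with index smaller than the optimal arm satisfies the selection test: for every j < i*, there exists some k > j (namely k = i*) with C_k − C_j ≤ p_{jk}; equivalently, j does not belong to the set {i ∈ {1,…,K} : for all k > i, C_k − C_i > p_{ik}}. -/

import Mathlib

open MeasureTheory ProbabilityTheory

/-- The probability that two functions differ satisfies the triangle inequality. -/
theorem measureReal_ne_le_add {Ω β : Type*} [MeasurableSpace Ω] (P : Measure Ω)
    [IsFiniteMeasure P] (f g h : Ω → β) :
    P.real {ω | f ω ≠ h ω} ≤ P.real {ω | f ω ≠ g ω} + P.real {ω | g ω ≠ h ω} := by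
  refine (measureReal_mono ?_).trans (measureReal_union_le _ _)
  intro ω hω
  by_contra hn
  simp only [Set.mem_union, Set.mem_ofPred_eq, not_or, not_not] at hn
  exact hω (hn.1.trans hn.2)

/-- No arm with index smaller than the optimal arm satisfies the selection
test: for every `j < i⋆`, there exists some `k > j` (namely `k = i⋆`) with
`C_k − C_j ≤ p_{jk}`; equivalently, `j` does not belong to the set
`{i : ∀ k > i, C_k − C_i > p_{ik}}`. -/
theorem suboptimal_below_fails_selection_test
    {Ω : Type*} [MeasurableSpace Ω] (P : Measure Ω) [IsProbabilityMeasure P]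
    {K : ℕ} (Y : Ω → Bool) (Yarm : Fin K → Ω → Bool)
    (hY : Measurable Y) (hYarm : ∀ i, Measurable (Yarm i))
    (γ : Fin K → ℝ) (hγ : ∀ i, γ i = (P {ω | Yarm i ω ≠ Y ω}).toReal)
    (p : Fin K → Fin K → ℝ) (hp : ∀ i j, p i j = (P {ω | Yarm i ω ≠ Yarm j ω}).toReal)
    (c : Fin K → ℝ) (hc : ∀ i, 0 ≤ c i)
    (C : Fin K → ℝ) (hC : ∀ i, C i = ∑ k ∈ Finset.Iic i, c k)
    (istar : Fin K)
    (hmin : ∀ i, γ istar + C istar ≤ γ i + C i)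
    (hmax : ∀ i, γ i + C i = γ istar + C istar → i ≤ istar) :
    ∀ j, j < istar →
      ((∃ k, j < k ∧ C k - C j ≤ p j k) ∧
        j ∉ {i : Fin K | ∀ k, i < k → p i k < C k - C i}) := by
  intro j hj
  have htri : γ j ≤ p j istar + γ istar := by
    rw [hγ, hγ, hp]
    exact measureReal_ne_le_add P (Yarm j) (Yarm istar) Y
  have htest : C istar - C j ≤ p j istar := by linarith [hmin j]
  exact ⟨⟨istar, hj, htest⟩, fun hmem => (hmem istar hj).not_ge htest⟩
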